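/- There is a constant C > 0 such that for every measurable function φ : (0,∞) → ℂ, every A > 0 with |φ(t)| ≤ A for almost every t > 0, and all x, y ∈ ℝ with x ≠ y, the integral defining K_φ^H(x,y) converges absolutely and |K_φ^H(x,y)| ≤ C · A/|x-y|. -/

import Mathlib

open MeasureTheory Set

/-- The Hermite heat kernel `W_t^H(x,y)`. -/
noncomputable def WH (t x y : ℝ) : ℝ :=
  (1 / Real.sqrt Real.pi) * Real.sqrt (Real.exp (-t) / (1 - Real.exp (-2*t))) *
    Real.exp (-(((x - Real.exp (-t) * y)^2 + (y - Real.exp (-t) * x)^2) /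
      (2 * (1 - Real.exp (-2*t)))))

/-- The kernel `K_φ^H(x,y) = ∫_0^∞ φ(t) (-∂_t W_t^H(x,y)) dt`. -/
noncomputable def KH (φ : ℝ → ℂ) (x y : ℝ) : ℂ :=
  ∫ t in Set.Ioi (0:ℝ), φ t * ((-(deriv (fun s => WH s x y) t) : ℝ) : ℂ)

open Filter Topology

lemma one_sub_exp_neg_two_mul_pos {t : ℝ} (ht : 0 < t) : 0 < 1 - Real.exp (-2 * t) :=
  sub_pos.2 (Real.exp_lt_one_iff.2 (by linarith))

lemma WH_nonneg (t x y : ℝ) : 0 ≤ WH t x y := by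
  unfold WH; positivity

lemma WH_eq_sinh_cosh {t : ℝ} (ht : 0 < t) (x y : ℝ) :
    WH t x y = (1 / √Real.pi) * √((2 * Real.sinh t)⁻¹) *
      Real.exp (-(((x ^ 2 + y ^ 2) * Real.cosh t - 2 * (x * y)) / (2 * Real.sinh t))) := by
  have hr : 0 < Real.exp (-t) := Real.exp_pos _
  have h1 : 1 - Real.exp (-t) ^ 2 ≠ 0 := by
    have := one_sub_exp_neg_two_mul_pos ht
    rw [← Real.exp_nat_mul]; push_cast; rw [show (2 : ℝ) * -t = -2 * t by ring]; exact this.ne'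
  have h2 : Real.exp (-2 * t) = Real.exp (-t) ^ 2 := by
    rw [← Real.exp_nat_mul]; push_cast; ring_nf
  have h3 : Real.exp t = (Real.exp (-t))⁻¹ := by rw [Real.exp_neg, inv_inv]
  unfold WH
  rw [h2, Real.sinh_eq, Real.cosh_eq, h3]
  generalize Real.exp (-t) = r at *
  have h4 : r⁻¹ - r ≠ 0 := by
    intro h
    apply h1
    field_simp at h
    linarith
  congr 3
  · field_simp
  · rw [div_eq_div_iff (by simpa using h1)
      (mul_ne_zero two_ne_zero (div_ne_zero h4 two_ne_zero))]
    field_simp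
    ring

lemma hasDerivAt_WH {t : ℝ} (ht : 0 < t) (x y : ℝ) :
    HasDerivAt (fun s => WH s x y)
      (WH t x y * (Real.cosh t / (2 * Real.sinh t ^ 2)) *
        ((x ^ 2 + y ^ 2) / Real.cosh t - 2 * (x * y) - Real.sinh t)) t := by
  have hs : 0 < Real.sinh t := Real.sinh_pos_iff.2 ht
  have hc : 0 < Real.cosh t := Real.cosh_pos t
  have hev : (fun s => WH s x y) =ᶠ[𝓝 t] fun s => (1 / √Real.pi) * √((2 * Real.sinh s)⁻¹) *
      Real.exp (-(((x ^ 2 + y ^ 2) * Real.cosh s - 2 * (x * y)) / (2 * Real.sinh s))) := by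
    filter_upwards [eventually_gt_nhds ht] with s hs using WH_eq_sinh_cosh hs x y
  refine HasDerivAt.congr_of_eventuallyEq ?_ hev
  have hd : HasDerivAt (fun s => 2 * Real.sinh s) (2 * Real.cosh t) t :=
    (Real.hasDerivAt_sinh t).const_mul 2
  have hA := ((hd.inv (by positivity)).sqrt (inv_ne_zero (by positivity))).const_mul
    (1 / √Real.pi)
  have hE := ((((Real.hasDerivAt_cosh t).const_mul (x ^ 2 + y ^ 2)).sub_const
    (2 * (x * y))).div hd (by positivity)).neg.exp
  refine (hA.mul hE).congr_deriv ?_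
  rw [WH_eq_sinh_cosh ht]
  have hq : 0 < √((2 * Real.sinh t)⁻¹) := Real.sqrt_pos.2 (by positivity)
  have hq2 : √((2 * Real.sinh t)⁻¹) ^ 2 = (2 * Real.sinh t)⁻¹ := Real.sq_sqrt (by positivity)
  have hcs := Real.cosh_sq t
  simp only [Pi.inv_apply, Pi.div_apply, Pi.neg_apply] at *
  generalize Real.exp _ = E
  generalize √((2 * Real.sinh t)⁻¹) = q at *
  have hk : (2 * q)⁻¹ = Real.sinh t * q := by
    field_simp at hq2 ⊢
    linarith
  generalize Real.cosh t = c at *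
  generalize Real.sinh t = s at *
  rw [div_eq_mul_inv _ (2 * q), hk]
  field_simp
  rw [show s ^ 2 = c ^ 2 - 1 by linarith]
  ring

lemma WH_le_exp {t : ℝ} (ht : 0 < t) (x y : ℝ) :
    WH t x y ≤ √(1 - Real.exp (-2 * t))⁻¹ *
      Real.exp (-((x - y) ^ 2 / 4 * (1 - Real.exp (-2 * t))⁻¹)) := by
  have h0 := one_sub_exp_neg_two_mul_pos ht
  have hr : 0 < Real.exp (-t) := Real.exp_pos _
  have hr1 : Real.exp (-t) ≤ 1 := Real.exp_le_one_iff.2 (by linarith)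
  have hpi : 1 / √Real.pi ≤ 1 := by
    rw [div_le_one (by positivity)]
    exact Real.one_le_sqrt.2 (by linarith [Real.pi_gt_three])
  unfold WH
  refine mul_le_mul ?_ ?_ (by positivity) (by positivity)
  · calc _ ≤ 1 * √(Real.exp (-t) / (1 - Real.exp (-2 * t))) := by gcongr
      _ ≤ _ := by
        rw [one_mul]
        apply Real.sqrt_le_sqrt
        rw [inv_eq_one_div]
        gcongr
  · apply Real.exp_le_exp.2
    apply neg_le_neg
    rw [← div_eq_mul_inv, div_div, div_le_div_iff₀ (by positivity) (by positivity)]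
    have key : (x - y) ^ 2 ≤
        2 * ((x - Real.exp (-t) * y) ^ 2 + (y - Real.exp (-t) * x) ^ 2) := by
      have : (1 + Real.exp (-t)) ^ 2 * (x - y) ^ 2 ≥ 1 * (x - y) ^ 2 := by
        gcongr; nlinarith
      nlinarith [sq_nonneg ((x - Real.exp (-t) * y) + (y - Real.exp (-t) * x))]
    nlinarith

lemma WH_le_div_abs_sub {t : ℝ} (ht : 0 < t) {x y : ℝ} (hxy : x ≠ y) :
    WH t x y ≤ 2 / |x - y| := by
  refine (WH_le_exp ht x y).trans ?_
  have hb : 0 < |x - y| := abs_pos.2 (sub_ne_zero.2 hxy)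
  have hu : 0 < (1 - Real.exp (-2 * t))⁻¹ := inv_pos.2 (one_sub_exp_neg_two_mul_pos ht)
  generalize (1 - Real.exp (-2 * t))⁻¹ = u at *
  rw [← sq_abs (x - y)]
  generalize |x - y| = d at *
  have hq : 0 < √u := Real.sqrt_pos.2 hu
  have hq2 : u = √u ^ 2 := (Real.sq_sqrt hu.le).symm
  rw [Real.exp_neg, ← div_eq_mul_inv, div_le_div_iff₀ (Real.exp_pos _) hb]
  have := Real.add_one_le_exp (d ^ 2 / 4 * u)
  have h3 : d ^ 2 / 4 * u = (d * √u / 2) ^ 2 := by rw [mul_div_right_comm, mul_pow, ← hq2]; ring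
  nlinarith [sq_nonneg (d * √u / 2 - 1)]

lemma WH_le_sqrt_mul {t : ℝ} (ht : 0 < t) {x y : ℝ} (hxy : x ≠ y) :
    WH t x y ≤ 4 / (x - y) ^ 2 * √(1 - Real.exp (-2 * t)) := by
  refine (WH_le_exp ht x y).trans ?_
  have hb : 0 < (x - y) ^ 2 := by have := sub_ne_zero.2 hxy; positivity
  have hu : 0 < 1 - Real.exp (-2 * t) := one_sub_exp_neg_two_mul_pos ht
  generalize 1 - Real.exp (-2 * t) = u at *
  generalize (x - y) ^ 2 = d at *
  have hq : 0 < √u := Real.sqrt_pos.2 hu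
  have hq2 : u = √u ^ 2 := (Real.sq_sqrt hu.le).symm
  have := Real.add_one_le_exp (d / 4 * u⁻¹)
  calc √u⁻¹ * Real.exp (-(d / 4 * u⁻¹)) ≤ (√u)⁻¹ * (d / 4 * u⁻¹)⁻¹ := by
        rw [Real.exp_neg, Real.sqrt_inv]
        gcongr
        linarith
    _ = 4 / d * √u := by
        rw [hq2, Real.sqrt_sq hq.le]; field_simp

lemma continuousWithinAt_WH_zero {x y : ℝ} (hxy : x ≠ y) :
    ContinuousWithinAt (fun t => WH t x y) (Ici 0) 0 := by
  have h0 : WH 0 x y = 0 := by simp [WH]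
  have hlim : Tendsto (fun t : ℝ => 4 / (x - y) ^ 2 * √(1 - Real.exp (-2 * t))) (𝓝 0) (𝓝 0) := by
    have : Continuous fun t : ℝ => 4 / (x - y) ^ 2 * √(1 - Real.exp (-2 * t)) := by fun_prop
    simpa using this.tendsto 0
  change Tendsto _ _ (𝓝 (WH 0 x y))
  rw [h0]
  refine tendsto_of_tendsto_of_tendsto_of_le_of_le' tendsto_const_nhds
    (hlim.mono_left nhdsWithin_le_nhds) (Eventually.of_forall fun t => WH_nonneg t x y) ?_
  filter_upwards [self_mem_nhdsWithin] with t ht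
  rcases (mem_Ici.1 ht).eq_or_lt with rfl | h
  · simp [h0]
  · exact WH_le_sqrt_mul h hxy

lemma tendsto_WH_atTop (x y : ℝ) : Tendsto (fun t => WH t x y) atTop (𝓝 0) := by
  have he : Tendsto (fun t : ℝ => Real.exp (-t)) atTop (𝓝 0) := Real.tendsto_exp_neg_atTop_nhds_zero
  have he2 : Tendsto (fun t : ℝ => Real.exp (-2 * t)) atTop (𝓝 0) := by
    have := he.pow 2
    simp only [ne_eq, OfNat.ofNat_ne_zero, not_false_eq_true, zero_pow] at this
    refine this.congr fun t => ?_
    rw [← Real.exp_nat_mul]; push_cast; ring_nf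
  have hlim : Tendsto (fun t : ℝ => (1 / √Real.pi) *
      √(Real.exp (-t) / (1 - Real.exp (-2 * t)))) atTop (𝓝 0) := by
    have := ((he.div (he2.const_sub 1) (by norm_num)).sqrt).const_mul (1 / √Real.pi)
    simpa using this
  refine tendsto_of_tendsto_of_tendsto_of_le_of_le' tendsto_const_nhds hlim
    (Eventually.of_forall fun t => WH_nonneg t x y) ?_
  filter_upwards [eventually_gt_atTop 0] with t ht
  have h0 := one_sub_exp_neg_two_mul_pos ht
  unfold WH
  refine mul_le_of_le_one_right (by positivity) (Real.exp_le_one_iff.2 (neg_nonpos.2 ?_))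
  positivity

lemma exists_deriv_WH_sign_change {x y : ℝ} (hxy : x ≠ y) :
    ∃ t₀ > 0, (∀ t, 0 < t → t ≤ t₀ → 0 ≤ deriv (fun s => WH s x y) t) ∧
      ∀ t, t₀ ≤ t → deriv (fun s => WH s x y) t ≤ 0 := by
  set f : ℝ → ℝ := fun t => (x ^ 2 + y ^ 2) / Real.cosh t - 2 * (x * y) - Real.sinh t with hf
  have hb : 0 < (x - y) ^ 2 := by have := sub_ne_zero.2 hxy; positivity
  have hcont : Continuous f := by
    have : ∀ t, Real.cosh t ≠ 0 := fun t => (Real.cosh_pos t).ne'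
    have h1 := Real.continuous_cosh
    have h2 := Real.continuous_sinh
    fun_prop (disch := assumption)
  have hanti : ∀ s t, 0 ≤ s → s ≤ t → f t ≤ f s := by
    intro s t hs hst
    have h1 : Real.cosh s ≤ Real.cosh t :=
      Real.cosh_le_cosh.2 (by rwa [abs_of_nonneg hs, abs_of_nonneg (hs.trans hst)])
    have h2 : Real.sinh s ≤ Real.sinh t := Real.sinh_le_sinh.2 hst
    have := Real.cosh_pos s
    simp only [hf]
    gcongr
  have hf0 : 0 < f 0 := by simp [hf]; nlinarith
  have hT : f (Real.arsinh ((x - y) ^ 2)) ≤ 0 := by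
    have := div_le_self (add_nonneg (sq_nonneg x) (sq_nonneg y))
      (Real.one_le_cosh (Real.arsinh ((x - y) ^ 2)))
    simp only [hf, Real.sinh_arsinh]
    nlinarith
  obtain ⟨t₀, ht₀, hft⟩ := intermediate_value_Icc' (Real.arsinh_nonneg_iff.2 hb.le)
    hcont.continuousOn ⟨hT, hf0.le⟩
  have hpos : 0 < t₀ := ht₀.1.lt_of_ne (by rintro rfl; exact hf0.ne' hft)
  have hfac : ∀ t, 0 < t → 0 ≤ WH t x y * (Real.cosh t / (2 * Real.sinh t ^ 2)) := fun t _ =>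
    mul_nonneg (WH_nonneg t x y) (div_nonneg (Real.cosh_pos t).le (by positivity))
  refine ⟨t₀, hpos, fun t ht htt => ?_, fun t ht => ?_⟩
  · rw [(hasDerivAt_WH ht x y).deriv]
    exact mul_nonneg (hfac t ht) (hft ▸ hanti t t₀ ht.le htt)
  · have ht' := hpos.trans_le ht
    rw [(hasDerivAt_WH ht' x y).deriv]
    exact mul_nonpos_of_nonneg_of_nonpos (hfac t ht') (hft ▸ hanti t₀ t hpos.le ht)

lemma integrableOn_deriv_WH_and_integral_abs_le {x y : ℝ} (hxy : x ≠ y) :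
    IntegrableOn (deriv fun s => WH s x y) (Ioi 0) ∧
      ∫ t in Ioi (0 : ℝ), |deriv (fun s => WH s x y) t| ≤ 4 / |x - y| := by
  obtain ⟨t₀, ht₀, hinc, hdec⟩ := exists_deriv_WH_sign_change hxy
  have hd : ∀ t, 0 < t → HasDerivAt (fun s => WH s x y) (deriv (fun s => WH s x y) t) t :=
    fun t ht => (hasDerivAt_WH ht x y).differentiableAt.hasDerivAt
  have hcont : ContinuousOn (fun s => WH s x y) (Icc 0 t₀) := by
    intro t ht
    rcases ht.1.eq_or_lt with rfl | h
    · exact (continuousWithinAt_WH_zero hxy).mono Icc_subset_Ici_self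
    · exact (hd t h).continuousAt.continuousWithinAt
  have hI₁ : IntegrableOn (deriv fun s => WH s x y) (Ioc 0 t₀) :=
    intervalIntegral.integrableOn_deriv_of_nonneg hcont (fun t ht => hd t ht.1)
      fun t ht => hinc t ht.1 ht.2.le
  have hI₂ : IntegrableOn (deriv fun s => WH s x y) (Ioi t₀) :=
    integrableOn_Ioi_deriv_of_nonpos' (fun t ht => hd t (ht₀.trans_le ht))
      (fun t ht => hdec t (le_of_lt ht)) (tendsto_WH_atTop x y)
  have hv₁ : ∫ t in Ioc 0 t₀, |deriv (fun s => WH s x y) t| = WH t₀ x y := by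
    rw [setIntegral_congr_fun measurableSet_Ioc fun t ht => abs_of_nonneg (hinc t ht.1 ht.2),
      ← intervalIntegral.integral_of_le ht₀.le,
      intervalIntegral.integral_eq_sub_of_hasDerivAt_of_le ht₀.le hcont (fun t ht => hd t ht.1)
        ((intervalIntegrable_iff_integrableOn_Ioc_of_le ht₀.le).2 hI₁)]
    simp [WH]
  have hv₂ : ∫ t in Ioi t₀, |deriv (fun s => WH s x y) t| = WH t₀ x y := by
    rw [setIntegral_congr_fun measurableSet_Ioi fun t ht => abs_of_nonpos (hdec t (le_of_lt ht)),
      integral_neg, integral_Ioi_of_hasDerivAt_of_nonpos' (fun t ht => hd t (ht₀.trans_le ht))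
      (fun t ht => hdec t (le_of_lt ht)) (tendsto_WH_atTop x y)]
    ring
  rw [← Ioc_union_Ioi_eq_Ioi ht₀.le]
  refine ⟨hI₁.union hI₂, ?_⟩
  rw [setIntegral_union (Ioc_disjoint_Ioi le_rfl) measurableSet_Ioi hI₁.abs hI₂.abs, hv₁, hv₂]
  have := WH_le_div_abs_sub ht₀ hxy
  calc _ ≤ 2 / |x - y| + 2 / |x - y| := add_le_add this this
    _ = _ := by ring

theorem hermite_kernel_CZ_size_estimate :
    ∃ C > (0:ℝ), ∀ (φ : ℝ → ℂ) (A : ℝ), Measurable φ → 0 < A →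
      (∀ᵐ t ∂(volume.restrict (Set.Ioi (0:ℝ))), ‖φ t‖ ≤ A) →
      ∀ x y : ℝ, x ≠ y →
        IntegrableOn (fun t => φ t * ((-(deriv (fun s => WH s x y) t) : ℝ) : ℂ))
          (Set.Ioi (0:ℝ)) ∧
        ‖KH φ x y‖ ≤ C * A / |x - y| := by
  refine ⟨4, by norm_num, fun φ A hφ hA hbd x y hxy => ?_⟩
  obtain ⟨hint, hle⟩ := integrableOn_deriv_WH_and_integral_abs_le hxy
  refine ⟨Integrable.bdd_mul hint.neg.ofReal hφ.aestronglyMeasurable hbd, ?_⟩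
  calc ‖KH φ x y‖ ≤ ∫ t in Ioi (0 : ℝ), A * |deriv (fun s => WH s x y) t| := by
        refine norm_integral_le_of_norm_le (hint.abs.const_mul A) ?_
        filter_upwards [hbd] with t ht
        rw [norm_mul, Complex.norm_real, norm_neg, Real.norm_eq_abs]
        gcongr
    _ ≤ A * (4 / |x - y|) := by
        rw [integral_const_mul]
        gcongr
    _ = 4 * A / |x - y| := by ring
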